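/- For V, W ∈ ℍ, define R̂ = Im(W · conj V), L̂ = Im(conj V · W), S = (1/4)·(⟨3R̂ − L̂, j⟩·j + ⟨3R̂ − L̂, k⟩·k), and k^f(V, W) = 3·(|−R̂ + S|² + |R̂ − L̂ − S|² + |R̂ − S|² + |R̂|² + |S|²). Then for V = a + b·i + c·j + d·k and W = x + y·i + z·j + w·k (a,b,c,d,x,y,z,w ∈ ℝ): k^f(V,W) = 6x²c² + 6z²a² + 6x²d² + 6w²a² + 21d²z² + 21c²w² + 9z²b² + 9w²b² + 9y²d² + 9y²c² + 9b²x² + 9a²y² − 42dzcw − 18wbyd − 18yczb − 18bxay − 12aydz + 12aycw − 12bxcw + 12bxdz − 12xcza − 12xdwa. (This is the explicit vertical curvature formula: k^f(V,W) is the unnormalized sectional curvature of the plane spanned by V, W in the normal space ν_{q₀}(Σ) ≅ ℍ, computed via O'Neill's formula as 3|A(V̄,W̄)|².) -/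

import Mathlib

open scoped Quaternion RealInnerProductSpace

noncomputable section

/-- The quaternion `i`. -/
def qi : ℍ := ⟨0, 1, 0, 0⟩

/-- The quaternion `j`. -/
def qj : ℍ := ⟨0, 0, 1, 0⟩

/-- The quaternion `k`. -/
def qk : ℍ := ⟨0, 0, 0, 1⟩

@[simp] theorem qi_re : qi.re = 0 := rfl
@[simp] theorem qi_imI : qi.imI = 1 := rfl
@[simp] theorem qi_imJ : qi.imJ = 0 := rfl
@[simp] theorem qi_imK : qi.imK = 0 := rfl

@[simp] theorem qj_re : qj.re = 0 := rfl
@[simp] theorem qj_imI : qj.imI = 0 := rfl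
@[simp] theorem qj_imJ : qj.imJ = 1 := rfl
@[simp] theorem qj_imK : qj.imK = 0 := rfl

@[simp] theorem qk_re : qk.re = 0 := rfl
@[simp] theorem qk_imI : qk.imI = 0 := rfl
@[simp] theorem qk_imJ : qk.imJ = 0 := rfl
@[simp] theorem qk_imK : qk.imK = 1 := rfl

theorem inner_eq_coordinates (p q : ℍ) :
    ⟪p, q⟫ = p.re * q.re + p.imI * q.imI + p.imJ * q.imJ + p.imK * q.imK := by
  rw [Quaternion.inner_def]
  simp

/-- The explicit vertical curvature formula `k^f(V, W)` for the extended Wilking metric. -/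
theorem stmt_7 (a b c d x y z w : ℝ) (V W : ℍ)
    (hV : V = (a : ℍ) + b • qi + c • qj + d • qk)
    (hW : W = (x : ℍ) + y • qi + z • qj + w • qk)
    (Rh Lh S : ℍ)
    (hRh : Rh = (W * star V).im)
    (hLh : Lh = (star V * W).im)
    (hS : S = (1 / 4 : ℝ) • (⟪(3 : ℝ) • Rh - Lh, qj⟫ • qj + ⟪(3 : ℝ) • Rh - Lh, qk⟫ • qk)) :
    3 * (⟪-Rh + S, -Rh + S⟫ + ⟪Rh - Lh - S, Rh - Lh - S⟫ + ⟪Rh - S, Rh - S⟫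
        + ⟪Rh, Rh⟫ + ⟪S, S⟫)
      = 6*x^2*c^2 + 6*z^2*a^2 + 6*x^2*d^2 + 6*w^2*a^2 + 21*d^2*z^2 + 21*c^2*w^2
        + 9*z^2*b^2 + 9*w^2*b^2 + 9*y^2*d^2 + 9*y^2*c^2 + 9*b^2*x^2 + 9*a^2*y^2
        - 42*d*z*c*w - 18*w*b*y*d - 18*y*c*z*b - 18*b*x*a*y
        - 12*a*y*d*z + 12*a*y*c*w - 12*b*x*c*w + 12*b*x*d*z - 12*x*c*z*a - 12*x*d*w*a := by
  have hV_coords : V.re = a ∧ V.imI = b ∧ V.imJ = c ∧ V.imK = d := by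
    simp [hV]
  have hW_coords : W.re = x ∧ W.imI = y ∧ W.imJ = z ∧ W.imK = w := by
    simp [hW]
  obtain ⟨hV₀, hV₁, hV₂, hV₃⟩ := hV_coords
  obtain ⟨hW₀, hW₁, hW₂, hW₃⟩ := hW_coords
  have hRh_coords : Rh.re = 0 ∧ Rh.imI = y * a - x * b - z * d + w * c ∧
      Rh.imJ = z * a - x * c - w * b + y * d ∧ Rh.imK = w * a - x * d - y * c + z * b := by
    simp only [hRh, Quaternion.re_im, Quaternion.imI_im, Quaternion.imJ_im, Quaternion.imK_im,
      Quaternion.imI_mul, Quaternion.imJ_mul, Quaternion.imK_mul, Quaternion.re_star,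
      Quaternion.imI_star, Quaternion.imJ_star, Quaternion.imK_star,
      hV₀, hV₁, hV₂, hV₃, hW₀, hW₁, hW₂, hW₃]
    refine ⟨trivial, ?_, ?_, ?_⟩ <;> ring
  have hLh_coords : Lh.re = 0 ∧ Lh.imI = y * a - x * b + z * d - w * c ∧
      Lh.imJ = z * a - x * c + w * b - y * d ∧ Lh.imK = w * a - x * d + y * c - z * b := by
    simp only [hLh, Quaternion.re_im, Quaternion.imI_im, Quaternion.imJ_im, Quaternion.imK_im,
      Quaternion.imI_mul, Quaternion.imJ_mul, Quaternion.imK_mul, Quaternion.re_star,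
      Quaternion.imI_star, Quaternion.imJ_star, Quaternion.imK_star,
      hV₀, hV₁, hV₂, hV₃, hW₀, hW₁, hW₂, hW₃]
    refine ⟨trivial, ?_, ?_, ?_⟩ <;> ring
  have hS_coords : S.re = 0 ∧ S.imI = 0 ∧ S.imJ = (3 * Rh.imJ - Lh.imJ) / 4 ∧
      S.imK = (3 * Rh.imK - Lh.imK) / 4 := by
    refine ⟨?_, ?_, ?_, ?_⟩ <;> simp [hS, inner_eq_coordinates] <;> ring
  obtain ⟨hR₀, hR₁, hR₂, hR₃⟩ := hRh_coords
  obtain ⟨hL₀, hL₁, hL₂, hL₃⟩ := hLh_coords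
  obtain ⟨hS₀, hS₁, hS₂, hS₃⟩ := hS_coords
  simp only [inner_eq_coordinates, Quaternion.re_add, Quaternion.imI_add, Quaternion.imJ_add,
    Quaternion.imK_add, Quaternion.re_sub, Quaternion.imI_sub, Quaternion.imJ_sub,
    Quaternion.imK_sub, Quaternion.re_neg, Quaternion.imI_neg, Quaternion.imJ_neg,
    Quaternion.imK_neg, hS₀, hS₁, hS₂, hS₃, hR₀, hR₁, hR₂, hR₃, hL₀, hL₁, hL₂, hL₃]
  ring
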